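/- Let n ∈ ℕ with n ≥ 1 and β ∈ (0,1]. The flow map is bounded: for every R > 0 there exists C > 0 such that for every pointwise time-dependent C^{n,β}_0-vector field u with ∫₀¹ ‖u(t,·)‖_{n,β} dt ≤ R, its pointwise flow Φ_u satisfies sup_{t∈[0,1]} ‖Φ_u(t,·) − Id‖_{n,β} ≤ C. -/

import Mathlib

open Function Set Filter Topology MeasureTheory
open scoped ENNReal NNReal

noncomputable section

section Defs

variable {E F : Type*} [NormedAddCommGroup E] [NormedSpace ℝ E]
  [NormedAddCommGroup F] [NormedSpace ℝ F]

/-- `‖f‖_n = max_{0 ≤ l ≤ n} sup_x ‖f⁽ˡ⁾(x)‖`, as an extended real. -/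
def eCnb (n : ℕ) (f : E → F) : ℝ≥0∞ :=
  ⨆ (l : Fin (n + 1)) (x : E), (‖iteratedFDeriv ℝ (l : ℕ) f x‖₊ : ℝ≥0∞)

/-- The Hölder seminorm `[f]_{n,α}`, as an extended real. -/
def eHsemi (n : ℕ) (α : ℝ) (f : E → F) : ℝ≥0∞ :=
  ⨆ (x : E) (y : E) (_ : x ≠ y),
    (‖iteratedFDeriv ℝ n f x - iteratedFDeriv ℝ n f y‖₊ : ℝ≥0∞) / edist x y ^ α

/-- The Hölder norm `‖f‖_{n,α} = max(‖f‖_n, [f]_{n,α})`, as an extended real. -/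
def eHnorm (n : ℕ) (α : ℝ) (f : E → F) : ℝ≥0∞ := max (eCnb n f) (eHsemi n α f)

/-- The Hölder norm `‖f‖_{n,α}` as a real number (junk value `0` when infinite). -/
def hnorm (n : ℕ) (α : ℝ) (f : E → F) : ℝ := (eHnorm n α f).toReal

/-- Membership in the global Hölder space `C^{n,α}_b(E,F)`. -/
def MemCb (n : ℕ) (α : ℝ) (f : E → F) : Prop :=
  ContDiff ℝ (n : ℕ∞) f ∧ eHnorm n α f < ⊤

/-- Membership in `C^{n,α}_0(E,F)`: moreover all derivatives up to order `n`
vanish at infinity. -/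
def MemC0 (n : ℕ) (α : ℝ) (f : E → F) : Prop :=
  MemCb n α f ∧
    ∀ l ≤ n, Tendsto (fun x => ‖iteratedFDeriv ℝ l f x‖) (cocompact E) (𝓝 0)

end Defs

/-- `ℝ^d` -/
abbrev Euc (d : ℕ) : Type := EuclideanSpace ℝ (Fin d)

/-- Membership in the diffeomorphism group `D^{n,β}(ℝ^d)`:
`Φ - Id ∈ C^{n,β}_0` and `det dΦ(x) > 0` everywhere. -/
def MemD (d n : ℕ) (β : ℝ) (Φ : Euc d → Euc d) : Prop :=
  MemC0 n β (fun x => Φ x - x) ∧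
    ∀ x, 0 < LinearMap.det ((fderiv ℝ Φ x : Euc d →L[ℝ] Euc d) : Euc d →ₗ[ℝ] Euc d)

end

/-- A pointwise time-dependent `C^{n,β}_0`-vector field on `[0,1]`. -/
def PointwiseVF (d n : ℕ) (β : ℝ) (u : ℝ → Euc d → Euc d) : Prop :=
  (∀ t ∈ Icc (0 : ℝ) 1, MemC0 n β (u t)) ∧
  (∀ x, AEStronglyMeasurable (fun t => u t x) (volume.restrict (Icc (0 : ℝ) 1))) ∧
  IntegrableOn (fun t => hnorm n β (u t)) (Icc (0 : ℝ) 1)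

/-- `Φ` is a pointwise flow of `u` on `[0,1]`:
`Φ(t,x) = x + ∫₀ᵗ u(s,Φ(s,x)) ds` (with integrable integrand). -/
def IsPointwiseFlow {d : ℕ} (u Φ : ℝ → Euc d → Euc d) : Prop :=
  ∀ x, IntervalIntegrable (fun s => u s (Φ s x)) volume 0 1 ∧
    ∀ t ∈ Icc (0 : ℝ) 1, Φ t x = x + ∫ s in (0 : ℝ)..t, u s (Φ s x)

/-- Superposition of a Carathéodory function with a measurable function. -/
theorem aestronglyMeasurable_comp_of_continuous {α X Y : Type*} [MeasurableSpace α] {μ : Measure α}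
    [TopologicalSpace X] [NormedAddCommGroup Y] {g : α → X → Y} {y : α → X}
    (hg : ∀ x, AEStronglyMeasurable (fun s => g s x) μ) (hc : ∀ᵐ s ∂μ, Continuous (g s))
    (hy : AEStronglyMeasurable y μ) : AEStronglyMeasurable (fun s => g s (y s)) μ := by
  obtain ⟨z, hz, hyz⟩ := hy
  let z' := fun j => hz.approx j
  refine aestronglyMeasurable_of_tendsto_ae atTop (f := fun (j : ℕ) s => g s (z' j s))
    (fun j => ?_) ?_
  · have h1 : (fun s => g s (z' j s)) = fun s => ∑ c ∈ (z' j).range,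
        ((z' j) ⁻¹' {c}).indicator (fun s => g s c) s := by
      funext s
      rw [Finset.sum_eq_single (z' j s)]
      · simp
      · intro c _ hcs
        simp [hcs.symm]
      · intro h
        exact absurd ((z' j).mem_range_self s) h
    rw [h1]
    exact Finset.aestronglyMeasurable_fun_sum _ fun c _ =>
      (hg c).indicator ((z' j).measurableSet_fiber c)
  · filter_upwards [hc, hyz] with s hs hs'
    rw [hs']
    exact (hs.tendsto _).comp (hz.tendsto_approx s)

section HolderBound

universe v

variable {E F G H : Type v} [NormedAddCommGroup E] [NormedSpace ℝ E]
  [NormedAddCommGroup F] [NormedSpace ℝ F] [NormedAddCommGroup G] [NormedSpace ℝ G]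
  [NormedAddCommGroup H] [NormedSpace ℝ H]

/-- `f` is of class `C^k` and its Hölder norm `‖f‖_{k,β}` is at most `M`. -/
structure HolderBound (k : ℕ) (β M : ℝ) (f : E → F) : Prop where
  contDiff : ContDiff ℝ k f
  norm_le : ∀ l ≤ k, ∀ x, ‖iteratedFDeriv ℝ l f x‖ ≤ M
  holder : ∀ x y, ‖iteratedFDeriv ℝ k f x - iteratedFDeriv ℝ k f y‖ ≤ M * ‖x - y‖ ^ β

namespace HolderBound

variable {k n : ℕ} {β M N : ℝ} {f : E → F}

theorem nonneg (h : HolderBound k β M f) : 0 ≤ M :=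
  (norm_nonneg _).trans (h.norm_le 0 (Nat.zero_le _) 0)

theorem norm_apply_le (h : HolderBound k β M f) (x : E) : ‖f x‖ ≤ M := by
  simpa using h.norm_le 0 (Nat.zero_le _) x

theorem continuous (h : HolderBound k β M f) : Continuous f := h.contDiff.continuous

theorem mono (h : HolderBound k β M f) (hMN : M ≤ N) : HolderBound k β N f where
  contDiff := h.contDiff
  norm_le l hl x := (h.norm_le l hl x).trans hMN
  holder x y := (h.holder x y).trans (by gcongr)

theorem zero_iff (hβ : 0 < β) : HolderBound 0 β M f ↔
    (∀ x, ‖f x‖ ≤ M) ∧ ∀ x y, ‖f x - f y‖ ≤ M * ‖x - y‖ ^ β := by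
  have key (x y : E) : ‖iteratedFDeriv ℝ 0 f x - iteratedFDeriv ℝ 0 f y‖ = ‖f x - f y‖ := by
    simp only [iteratedFDeriv_zero_eq_comp, Function.comp_apply]
    rw [← map_sub, LinearIsometryEquiv.norm_map]
  constructor
  · exact fun h => ⟨h.norm_apply_le, fun x y => key x y ▸ h.holder x y⟩
  · rintro ⟨h1, h2⟩
    refine ⟨?_, fun l hl x => ?_, fun x y => key x y ▸ h2 x y⟩
    · rw [Nat.cast_zero, contDiff_zero, continuous_iff_continuousAt]
      intro x
      rw [ContinuousAt, tendsto_iff_norm_sub_tendsto_zero]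
      have h3 : Tendsto (fun y => M * ‖y - x‖ ^ β) (𝓝 x) (𝓝 (M * ‖x - x‖ ^ β)) := by
        have : Continuous fun y => M * ‖y - x‖ ^ β :=
          continuous_const.mul ((by fun_prop : Continuous fun y => ‖y - x‖).rpow_const
            fun _ => Or.inr hβ.le)
        exact this.tendsto x
      rw [sub_self, norm_zero, Real.zero_rpow hβ.ne', mul_zero] at h3
      exact squeeze_zero (fun _ => norm_nonneg _) (fun y => h2 y x) h3
    · obtain rfl : l = 0 := by omega
      simpa using h1 x

theorem succ_iff : HolderBound (k + 1) β M f ↔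
    Differentiable ℝ f ∧ (∀ x, ‖f x‖ ≤ M) ∧ HolderBound k β M (fderiv ℝ f) := by
  have key (x y : E) : ‖iteratedFDeriv ℝ (k + 1) f x - iteratedFDeriv ℝ (k + 1) f y‖ =
      ‖iteratedFDeriv ℝ k (fderiv ℝ f) x - iteratedFDeriv ℝ k (fderiv ℝ f) y‖ := by
    simp only [iteratedFDeriv_succ_eq_comp_right, Function.comp_apply, ← dist_eq_norm]
    exact LinearIsometryEquiv.dist_map _ _ _
  constructor
  · intro h
    have h1 := h.contDiff
    rw [Nat.cast_succ, contDiff_succ_iff_fderiv] at h1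
    refine ⟨h1.1, h.norm_apply_le, h1.2.2, fun l hl x => ?_, fun x y => key x y ▸ h.holder x y⟩
    rw [norm_iteratedFDeriv_fderiv]
    exact h.norm_le _ (by omega) x
  · rintro ⟨h1, h2, h3⟩
    refine ⟨?_, fun l hl x => ?_, fun x y => key x y ▸ h3.holder x y⟩
    · rw [Nat.cast_succ, contDiff_succ_iff_fderiv]
      exact ⟨h1, by simp, h3.contDiff⟩
    · cases l with
      | zero => simpa using h2 x
      | succ l =>
        rw [← norm_iteratedFDeriv_fderiv]
        exact h3.norm_le l (by omega) x

theorem differentiable (h : HolderBound (k + 1) β M f) : Differentiable ℝ f := (succ_iff.1 h).1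

theorem fderiv (h : HolderBound (k + 1) β M f) : HolderBound k β M (_root_.fderiv ℝ f) :=
  (succ_iff.1 h).2.2

theorem const (c : F) (hc : ‖c‖ ≤ M) : HolderBound k β M (fun _ : E => c) where
  contDiff := contDiff_const
  norm_le l _ x := by
    rcases eq_or_ne l 0 with rfl | hl
    · simpa using hc
    · simpa [iteratedFDeriv_const_of_ne hl] using (norm_nonneg c).trans hc
  holder x y := by
    have : 0 ≤ M := (norm_nonneg c).trans hc
    rcases eq_or_ne k 0 with rfl | hl
    · simp only [iteratedFDeriv_zero_eq_comp, Function.comp_apply, sub_self, norm_zero]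
      positivity
    · simp only [iteratedFDeriv_const_of_ne hl, Pi.zero_apply, sub_self, norm_zero]
      positivity

theorem add {g : E → F} (hf : HolderBound k β M f) (hg : HolderBound k β N g) :
    HolderBound k β (M + N) (fun x => f x + g x) := by
  have key (l : ℕ) (hl : l ≤ k) (x : E) : iteratedFDeriv ℝ l (fun x => f x + g x) x =
      iteratedFDeriv ℝ l f x + iteratedFDeriv ℝ l g x :=
    iteratedFDeriv_add_apply (hf.contDiff.contDiffAt.of_le (mod_cast hl))
      (hg.contDiff.contDiffAt.of_le (mod_cast hl))
  refine ⟨hf.contDiff.add hg.contDiff, fun l hl x => ?_, fun x y => ?_⟩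
  · rw [key l hl]
    exact (norm_add_le _ _).trans (add_le_add (hf.norm_le l hl x) (hg.norm_le l hl x))
  · rw [key k le_rfl, key k le_rfl, add_sub_add_comm, add_mul]
    exact (norm_add_le _ _).trans (add_le_add (hf.holder x y) (hg.holder x y))

theorem tsum [CompleteSpace F] {f : ℕ → E → F} {a : ℕ → ℝ}
    (hf : ∀ j, HolderBound k β (a j) (f j)) (ha : Summable a) :
    HolderBound k β (∑' j, a j) (fun x => ∑' j, f j x) := by
  have hC (j : ℕ) : ContDiff ℝ ((k : ℕ∞) : WithTop ℕ∞) (f j) := mod_cast (hf j).contDiff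
  have hb (l : ℕ) (j : ℕ) (x : E) (hl : (l : ℕ∞) ≤ k) : ‖iteratedFDeriv ℝ l (f j) x‖ ≤ a j :=
    (hf j).norm_le l (mod_cast hl) x
  have key (l : ℕ) (hl : l ≤ k) (x : E) : iteratedFDeriv ℝ l (fun x => ∑' j, f j x) x =
      ∑' j, iteratedFDeriv ℝ l (f j) x :=
    iteratedFDeriv_tsum_apply hC (v := fun _ => a) (fun _ _ => ha) hb (mod_cast hl) x
  have hs (x : E) : Summable fun j => iteratedFDeriv ℝ k (f j) x :=
    ha.of_norm_bounded fun j => (hf j).norm_le k le_rfl x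
  refine ⟨mod_cast contDiff_tsum hC (v := fun _ => a) (fun _ _ => ha) hb, fun l hl x => ?_,
    fun x y => ?_⟩
  · rw [key l hl]
    exact tsum_of_norm_bounded ha.hasSum fun j => (hf j).norm_le l hl x
  · rw [key k le_rfl, key k le_rfl, ← (hs x).tsum_sub (hs y)]
    exact tsum_of_norm_bounded (ha.hasSum.mul_right _) fun j => (hf j).holder x y

theorem of_lipschitz (hβ0 : 0 < β) (hβ1 : β ≤ 1) (hM : ∀ x, ‖f x‖ ≤ M)
    (hL : ∀ x y, ‖f x - f y‖ ≤ M * ‖x - y‖) : HolderBound 0 β (2 * M) f := by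
  have hM0 : 0 ≤ M := (norm_nonneg _).trans (hM 0)
  refine (zero_iff hβ0).2 ⟨fun x => (hM x).trans (by linarith), fun x y => ?_⟩
  rcases le_total ‖x - y‖ 1 with h | h
  · have h1 : ‖x - y‖ ≤ ‖x - y‖ ^ β := by
      simpa using Real.rpow_le_rpow_of_exponent_ge' (norm_nonneg _) h hβ0.le hβ1
    nlinarith [hL x y, mul_le_mul_of_nonneg_left h1 hM0, norm_nonneg (x - y)]
  · have h1 : 1 ≤ ‖x - y‖ ^ β := Real.one_le_rpow h hβ0.le
    nlinarith [norm_sub_le (f x) (f y), hM x, hM y]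

theorem of_succ (hβ0 : 0 < β) (hβ1 : β ≤ 1) (h : HolderBound (k + 1) β M f) :
    HolderBound k β (2 * M) f := by
  induction k generalizing F with
  | zero =>
    refine of_lipschitz hβ0 hβ1 h.norm_apply_le fun x y => ?_
    exact convex_univ.norm_image_sub_le_of_norm_fderiv_le (fun x _ => h.differentiable x)
      (fun x _ => h.fderiv.norm_apply_le x) (mem_univ y) (mem_univ x)
  | succ k ih =>
    refine succ_iff.2 ⟨h.differentiable, fun x => ?_, ih h.fderiv⟩
    linarith [h.norm_apply_le x, h.nonneg]

theorem of_le (hβ0 : 0 < β) (hβ1 : β ≤ 1) (hkn : k ≤ n) (h : HolderBound n β M f) :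
    HolderBound k β (2 ^ (n - k) * M) f := by
  obtain ⟨j, rfl⟩ := Nat.exists_eq_add_of_le hkn
  rw [Nat.add_sub_cancel_left]
  induction j generalizing M with
  | zero => simpa using h
  | succ j ih =>
    rw [pow_succ, mul_assoc]
    exact ih (Nat.le_add_right _ _) (h.of_succ hβ0 hβ1)

theorem bilinear (hβ0 : 0 < β) (hβ1 : β ≤ 1) (k : ℕ) (B : F →L[ℝ] G →L[ℝ] H) :
    ∃ c : ℝ, 0 ≤ c ∧ ∀ (f : E → F) (g : E → G) (M N : ℝ), HolderBound k β M f →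
      HolderBound k β N g → HolderBound k β (c * M * N) (fun x => B (f x) (g x)) := by
  induction k generalizing F G H with
  | zero =>
    refine ⟨2 * ‖B‖, by positivity, fun f g M N hf hg => ?_⟩
    have hM := hf.nonneg
    have hN := hg.nonneg
    have hB := norm_nonneg B
    refine (zero_iff hβ0).2 ⟨fun x => ?_, fun x y => ?_⟩
    · calc ‖B (f x) (g x)‖ ≤ ‖B‖ * ‖f x‖ * ‖g x‖ := B.le_opNorm₂ _ _
        _ ≤ ‖B‖ * M * N := by gcongr; exacts [hf.norm_apply_le x, hg.norm_apply_le x]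
        _ ≤ 2 * ‖B‖ * M * N := by nlinarith [mul_nonneg (mul_nonneg hB hM) hN]
    · have h1 : B (f x) (g x) - B (f y) (g y) = B (f x - f y) (g x) + B (f y) (g x - g y) := by
        simp
      have hf' := ((zero_iff hβ0).1 hf).2 x y
      have hg' := ((zero_iff hβ0).1 hg).2 x y
      calc ‖B (f x) (g x) - B (f y) (g y)‖
          ≤ ‖B‖ * ‖f x - f y‖ * ‖g x‖ + ‖B‖ * ‖f y‖ * ‖g x - g y‖ := by
            rw [h1]
            exact (norm_add_le _ _).trans (add_le_add (B.le_opNorm₂ _ _) (B.le_opNorm₂ _ _))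
        _ ≤ ‖B‖ * (M * ‖x - y‖ ^ β) * N + ‖B‖ * M * (N * ‖x - y‖ ^ β) := by
            gcongr
            exacts [hg.norm_apply_le x, hf.norm_apply_le y]
        _ = 2 * ‖B‖ * M * N * ‖x - y‖ ^ β := by ring
  | succ k ih =>
    obtain ⟨c₁, hc₁, h₁⟩ := ih (B.precompR E)
    obtain ⟨c₂, hc₂, h₂⟩ := ih (B.precompL E)
    refine ⟨‖B‖ + (2 * c₁ + 2 * c₂), by positivity, fun f g M N hf hg => ?_⟩
    have hM := hf.nonneg
    have hN := hg.nonneg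
    have hB := norm_nonneg B
    have hMN := mul_nonneg hM hN
    have hd : Differentiable ℝ fun x => B (f x) (g x) := fun x =>
      (B.hasFDerivAt_of_bilinear (hf.differentiable x).hasFDerivAt
        (hg.differentiable x).hasFDerivAt).differentiableAt
    have hd' : _root_.fderiv ℝ (fun x => B (f x) (g x)) = fun x =>
        B.precompR E (f x) (_root_.fderiv ℝ g x) + B.precompL E (_root_.fderiv ℝ f x) (g x) :=
      funext fun x => B.fderiv_of_bilinear (hf.differentiable x) (hg.differentiable x)
    refine succ_iff.2 ⟨hd, fun x => ?_, ?_⟩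
    · calc ‖B (f x) (g x)‖ ≤ ‖B‖ * ‖f x‖ * ‖g x‖ := B.le_opNorm₂ _ _
        _ ≤ ‖B‖ * M * N := by gcongr; exacts [hf.norm_apply_le x, hg.norm_apply_le x]
        _ ≤ (‖B‖ + (2 * c₁ + 2 * c₂)) * M * N := by
            gcongr
            linarith
    · rw [hd']
      refine ((h₁ _ _ _ _ (hf.of_succ hβ0 hβ1) hg.fderiv).add
        (h₂ _ _ _ _ hf.fderiv (hg.of_succ hβ0 hβ1))).mono ?_
      nlinarith [mul_nonneg hB hMN]

theorem comp_id_add (hβ0 : 0 < β) (hβ1 : β ≤ 1) (k : ℕ) {N L : ℝ} (hN : 0 ≤ N) (hL : 0 ≤ L) :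
    ∃ c : ℝ, 0 ≤ c ∧ ∀ (f : E → F) (Φ : E → E) (M : ℝ), HolderBound k β M f →
      HolderBound k β N (fun x => Φ x - x) → (∀ x y, ‖Φ x - Φ y‖ ≤ L * ‖x - y‖) →
      HolderBound k β (c * M) (fun x => f (Φ x)) := by
  induction k generalizing F N with
  | zero =>
    refine ⟨1 + L ^ β, by positivity, fun f Φ M hf _ hΦ => ?_⟩
    have hM := hf.nonneg
    have hLβ : 0 ≤ L ^ β := by positivity
    refine (zero_iff hβ0).2 ⟨fun x => ?_, fun x y => ?_⟩
    · nlinarith [hf.norm_apply_le (Φ x)]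
    · calc ‖f (Φ x) - f (Φ y)‖ ≤ M * ‖Φ x - Φ y‖ ^ β := ((zero_iff hβ0).1 hf).2 _ _
        _ ≤ M * (L * ‖x - y‖) ^ β := by gcongr; exact hΦ x y
        _ = L ^ β * M * ‖x - y‖ ^ β := by
            rw [Real.mul_rpow hL (norm_nonneg _)]; ring
        _ ≤ (1 + L ^ β) * M * ‖x - y‖ ^ β := by gcongr; linarith
  | succ k ih =>
    obtain ⟨c, hc, h⟩ := ih (F := E →L[ℝ] F) (N := 2 * N) (by positivity)
    obtain ⟨b, hb, h'⟩ := bilinear (E := E) hβ0 hβ1 k (ContinuousLinearMap.compL ℝ E E F)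
    refine ⟨1 + (c + b * c * N), by positivity, fun f Φ M hf hφ hΦ => ?_⟩
    have hM := hf.nonneg
    have hΦd : Differentiable ℝ Φ := by
      simpa using hφ.differentiable.add differentiable_id
    have hd' : _root_.fderiv ℝ (fun x => f (Φ x)) = fun x => _root_.fderiv ℝ f (Φ x) +
        ContinuousLinearMap.compL ℝ E E F (_root_.fderiv ℝ f (Φ x))
          (_root_.fderiv ℝ (fun x => Φ x - x) x) := by
      funext x
      have h1 : HasFDerivAt (fun x => Φ x - x) (_root_.fderiv ℝ Φ x - .id ℝ E) x :=
        (hΦd x).hasFDerivAt.sub (hasFDerivAt_id x)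
      have h2 : HasFDerivAt (fun x => f (Φ x)) (_root_.fderiv ℝ f (Φ x) ∘L _root_.fderiv ℝ Φ x) x :=
        (hf.differentiable (Φ x)).hasFDerivAt.comp x (hΦd x).hasFDerivAt
      rw [h1.fderiv, h2.fderiv]
      ext v
      simp
    refine succ_iff.2 ⟨hf.differentiable.comp hΦd, fun x => ?_, ?_⟩
    · nlinarith [hf.norm_apply_le (Φ x),
        mul_nonneg (add_nonneg hc (mul_nonneg (mul_nonneg hb hc) hN)) hM]
    · rw [hd']
      have h1 := h _ _ _ hf.fderiv (hφ.of_succ hβ0 hβ1) hΦ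
      refine (h1.add (h' _ _ _ _ h1 hφ.fderiv)).mono ?_
      nlinarith

theorem norm_sub_sub_fderiv_le (hβ : 0 < β) (hf : HolderBound 1 β M f) (x y : E) :
    ‖f y - f x - _root_.fderiv ℝ f x (y - x)‖ ≤ M * ‖y - x‖ ^ β * ‖y - x‖ := by
  refine Convex.norm_image_sub_le_of_norm_hasFDerivWithin_le' (s := segment ℝ x y)
    (fun z _ => (hf.differentiable z).hasFDerivAt.hasFDerivWithinAt) (fun z hz => ?_)
    (convex_segment x y) (left_mem_segment ℝ x y) (right_mem_segment ℝ x y)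
  have hM := hf.nonneg
  calc ‖_root_.fderiv ℝ f z - _root_.fderiv ℝ f x‖ ≤ M * ‖z - x‖ ^ β :=
        ((zero_iff hβ).1 hf.fderiv).2 z x
    _ ≤ M * ‖y - x‖ ^ β := by
        gcongr
        exact norm_sub_le_of_mem_segment hz

theorem of_eHnorm_le (hM : 0 ≤ M) (hf : ContDiff ℝ (n : ℕ∞) f)
    (h : eHnorm n β f ≤ ENNReal.ofReal M) : HolderBound n β M f := by
  refine ⟨mod_cast hf, fun l hl x => ?_, fun x y => ?_⟩
  · have h1 : (‖iteratedFDeriv ℝ l f x‖₊ : ℝ≥0∞) ≤ ENNReal.ofReal M :=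
      (le_iSup₂_of_le (f := fun (l : Fin (n + 1)) (x : E) =>
        (‖iteratedFDeriv ℝ (l : ℕ) f x‖₊ : ℝ≥0∞)) ⟨l, by omega⟩ x le_rfl).trans
        ((le_max_left _ _).trans h)
    rwa [← enorm_eq_nnnorm, ← ofReal_norm, ENNReal.ofReal_le_ofReal_iff hM] at h1
  · rcases eq_or_ne x y with rfl | hxy
    · simp only [sub_self, norm_zero]
      positivity
    · have h1 : (‖iteratedFDeriv ℝ n f x - iteratedFDeriv ℝ n f y‖₊ : ℝ≥0∞) / edist x y ^ β ≤
          ENNReal.ofReal M :=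
        (le_iSup_of_le x (le_iSup_of_le y (le_iSup (fun _ : x ≠ y => _) hxy))).trans
          ((le_max_right _ _).trans h)
      have hpos : 0 < ‖x - y‖ := norm_pos_iff.2 (sub_ne_zero.2 hxy)
      rw [← enorm_eq_nnnorm, ← ofReal_norm, edist_dist, dist_eq_norm,
        ENNReal.ofReal_rpow_of_pos hpos, ← ENNReal.ofReal_div_of_pos (by positivity),
        ENNReal.ofReal_le_ofReal_iff hM, div_le_iff₀ (by positivity)] at h1
      exact h1

theorem eHnorm_le (h : HolderBound n β M f) : eHnorm n β f ≤ ENNReal.ofReal M := by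
  refine max_le (iSup₂_le fun l x => ?_) (iSup₂_le fun x y => iSup_le fun hxy => ?_)
  · rw [← enorm_eq_nnnorm, ← ofReal_norm]
    exact ENNReal.ofReal_le_ofReal (h.norm_le l (by omega) x)
  · have hpos : 0 < ‖x - y‖ := norm_pos_iff.2 (sub_ne_zero.2 hxy)
    rw [← enorm_eq_nnnorm, ← ofReal_norm, edist_dist, dist_eq_norm,
      ENNReal.ofReal_rpow_of_pos hpos, ← ENNReal.ofReal_div_of_pos (by positivity)]
    exact ENNReal.ofReal_le_ofReal ((div_le_iff₀ (by positivity)).2 (h.holder x y))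

end HolderBound

theorem MemC0.holderBound {n : ℕ} {β : ℝ} {f : E → F} (h : MemC0 n β f) :
    HolderBound n β (hnorm n β f) f :=
  .of_eHnorm_le ENNReal.toReal_nonneg h.1.1 (ENNReal.ofReal_toReal h.1.2.ne).ge

section Measurability

variable {α : Type*} [MeasurableSpace α] {μ : Measure α}

theorem aestronglyMeasurable_clm_of_apply [FiniteDimensional ℝ E] {L : α → E →L[ℝ] F}
    (h : ∀ v, AEStronglyMeasurable (fun s => L s v) μ) : AEStronglyMeasurable L μ := by
  let b := Module.finBasis ℝ E
  have hL : L = fun s => ∑ i, (LinearMap.toContinuousLinearMap (b.coord i)).smulRight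
      (L s (b i)) := by
    funext s
    ext v
    conv_lhs => rw [← b.sum_repr v, map_sum]
    simp
  rw [hL]
  refine Finset.aestronglyMeasurable_fun_sum _ fun i _ => ?_
  exact (ContinuousLinearMap.smulRightL ℝ E F
    (LinearMap.toContinuousLinearMap (b.coord i))).continuous.comp_aestronglyMeasurable (h (b i))

theorem aestronglyMeasurable_fderiv_of_apply [FiniteDimensional ℝ E] {g : α → E → F} {y : α → E}
    (hg : ∀ v, AEStronglyMeasurable (fun s => g s (y s + v)) μ)
    (hd : ∀ᵐ s ∂μ, DifferentiableAt ℝ (g s) (y s)) :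
    AEStronglyMeasurable (fun s => fderiv ℝ (g s) (y s)) μ := by
  refine aestronglyMeasurable_clm_of_apply fun v => ?_
  let c : ℕ → ℝ := fun j => (j : ℝ) + 1
  refine aestronglyMeasurable_of_tendsto_ae atTop
    (f := fun (j : ℕ) s => c j • (g s (y s + (c j)⁻¹ • v) - g s (y s)))
    (fun j => ((hg _).sub (by simpa using hg 0)).const_smul _) ?_
  filter_upwards [hd] with s hs
  have hc : Tendsto (fun j => ‖c j‖) atTop atTop :=
    tendsto_norm_atTop_atTop.comp (tendsto_atTop_add_const_right _ _ tendsto_natCast_atTop_atTop)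
  refine hs.hasFDerivAt.lim v hc

theorem HolderBound.integral [FiniteDimensional ℝ E] {k : ℕ} {β : ℝ} (hβ : 0 < β)
    {g : α → E → F} {m : α → ℝ} (hg : ∀ x, AEStronglyMeasurable (fun s => g s x) μ)
    (hb : ∀ᵐ s ∂μ, HolderBound k β (m s) (g s)) (hm : Integrable m μ) :
    HolderBound k β (∫ s, m s ∂μ) (fun x => ∫ s, g s x ∂μ) := by
  have hint (x : E) : Integrable (fun s => g s x) μ :=
    hm.mono' (hg x) (hb.mono fun s hs => hs.norm_apply_le x)
  induction k generalizing F with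
  | zero =>
    refine (zero_iff hβ).2 ⟨fun x => norm_integral_le_of_norm_le hm
      (hb.mono fun s hs => hs.norm_apply_le x), fun x y => ?_⟩
    rw [← integral_sub (hint x) (hint y), ← integral_mul_const]
    exact norm_integral_le_of_norm_le (hm.mul_const _)
      (hb.mono fun s hs => ((zero_iff hβ).1 hs).2 x y)
  | succ k ih =>
    have hmeas (x : E) : AEStronglyMeasurable (fun s => _root_.fderiv ℝ (g s) x) μ :=
      aestronglyMeasurable_fderiv_of_apply (y := fun _ => x) (fun v => hg (x + v))
        (hb.mono fun s hs => hs.differentiable x)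
    have hb' : ∀ᵐ s ∂μ, HolderBound k β (m s) (_root_.fderiv ℝ (g s)) :=
      hb.mono fun s hs => hs.fderiv
    have hd (x : E) : HasFDerivAt (fun x => ∫ s, g s x ∂μ) (∫ s, _root_.fderiv ℝ (g s) x ∂μ) x :=
      hasFDerivAt_integral_of_dominated_of_fderiv_le (F' := fun x s => _root_.fderiv ℝ (g s) x)
        univ_mem (.of_forall hg) (hint x) (hmeas x)
        (hb'.mono fun s hs x _ => hs.norm_apply_le x) hm
        (hb.mono fun s hs x _ => (hs.differentiable x).hasFDerivAt)
    refine succ_iff.2 ⟨fun x => (hd x).differentiableAt, fun x => norm_integral_le_of_norm_le hm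
      (hb.mono fun s hs => hs.norm_apply_le x), ?_⟩
    rw [funext fun x => (hd x).fderiv]
    exact ih hmeas hb' fun x =>
      hm.mono' (hmeas x) (hb'.mono fun s hs => hs.norm_apply_le x)

end Measurability

end HolderBound

section Gronwall

variable {m : ℝ → ℝ}

theorem continuousOn_primitive_Icc {F : Type*} [NormedAddCommGroup F] [NormedSpace ℝ F] {f : ℝ → F}
    (hf : IntervalIntegrable f volume 0 1) :
    ContinuousOn (fun t => ∫ s in (0 : ℝ)..t, f s) (Icc 0 1) := by
  have h := intervalIntegral.continuousOn_primitive_interval (μ := volume) (a := (0 : ℝ)) (b := 1)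
    (f := f) ((intervalIntegrable_iff_integrableOn_Icc_of_le zero_le_one).1 hf |>.mono_set
      (by rw [uIcc_of_le zero_le_one]))
  rwa [uIcc_of_le zero_le_one] at h

theorem IntervalIntegrable.mono_Icc {F : Type*} [NormedAddCommGroup F] {f : ℝ → F}
    (hf : IntervalIntegrable f volume 0 1) {s t : ℝ} (hs : s ∈ Icc (0 : ℝ) 1)
    (ht : t ∈ Icc (0 : ℝ) 1) : IntervalIntegrable f volume s t :=
  hf.mono_set (uIcc_subset_uIcc (by rwa [uIcc_of_le zero_le_one])
    (by rwa [uIcc_of_le zero_le_one]))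

theorem monotoneOn_primitive (hm : IntervalIntegrable m volume 0 1)
    (hm0 : ∀ s ∈ Icc (0 : ℝ) 1, 0 ≤ m s) :
    MonotoneOn (fun t => ∫ s in (0 : ℝ)..t, m s) (Icc 0 1) := by
  intro s hs t ht hst
  have h0 : (0 : ℝ) ∈ Icc (0 : ℝ) 1 := by simp
  rw [← sub_nonneg, intervalIntegral.integral_interval_sub_left (hm.mono_Icc h0 ht)
    (hm.mono_Icc h0 hs)]
  exact intervalIntegral.integral_nonneg hst fun r hr => hm0 r ⟨hs.1.trans hr.1, hr.2.trans ht.2⟩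

theorem integral_mul_exp_primitive_le (hm : IntervalIntegrable m volume 0 1)
    (hm0 : ∀ s ∈ Icc (0 : ℝ) 1, 0 ≤ m s) {t : ℝ} (ht : t ∈ Icc (0 : ℝ) 1) :
    ∫ s in (0 : ℝ)..t, m s * Real.exp (∫ r in (0 : ℝ)..s, m r) ≤
      Real.exp (∫ r in (0 : ℝ)..t, m r) - 1 := by
  let f : ℝ → ℝ := fun s => Real.exp (∫ r in (0 : ℝ)..s, m r)
  have h0 : (0 : ℝ) ∈ Icc (0 : ℝ) 1 := by simp
  have hsub : uIcc 0 t ⊆ Icc (0 : ℝ) 1 := by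
    rw [uIcc_of_le ht.1]; exact Icc_subset_Icc_right ht.2
  have hf : MonotoneOn f (uIcc 0 t) := fun a ha b hb hab =>
    Real.exp_le_exp.2 (monotoneOn_primitive hm hm0 (hsub ha) (hsub hb) hab)
  have hft : 0 ≤ f t - f 0 := sub_nonneg.2 (hf left_mem_uIcc right_mem_uIcc ht.1)
  have h1 := hf.intervalIntegral_deriv_mem_uIcc
  rw [uIcc_of_le hft] at h1
  have h2 : ∫ s in (0 : ℝ)..t, m s * f s = ∫ s in (0 : ℝ)..t, deriv f s := by
    refine intervalIntegral.integral_congr_ae ?_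
    filter_upwards [(hm.mono_Icc h0 ht).ae_hasDerivAt_integral] with s hs hst
    rw [((hs (uIoc_subset_uIcc hst) 0 left_mem_uIcc).exp).deriv, mul_comm]
  rw [h2]
  simpa [f] using h1.2

theorem integral_mul_exp_two_mul_le (hm : IntervalIntegrable m volume 0 1)
    (hm0 : ∀ s ∈ Icc (0 : ℝ) 1, 0 ≤ m s) {t : ℝ} (ht : t ∈ Icc (0 : ℝ) 1) :
    ∫ s in (0 : ℝ)..t, m s * Real.exp (2 * ∫ r in (0 : ℝ)..s, m r) ≤
      (1 / 2) * Real.exp (2 * ∫ r in (0 : ℝ)..t, m r) := by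
  have h := integral_mul_exp_primitive_le (hm.const_mul 2)
    (fun s hs => mul_nonneg zero_le_two (hm0 s hs)) ht
  simp only [intervalIntegral.integral_const_mul, mul_assoc] at h
  linarith

theorem intervalIntegrable_mul_of_continuousOn {f : ℝ → ℝ} (hm : IntervalIntegrable m volume 0 1)
    (hf : ContinuousOn f (Icc 0 1)) : IntervalIntegrable (fun s => m s * f s) volume 0 1 :=
  hm.mul_continuousOn (by rwa [uIcc_of_le zero_le_one])

/-- Grönwall's inequality with an integrable kernel (with a non-optimal constant). -/
theorem gronwall_integrable (hm : IntervalIntegrable m volume 0 1)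
    (hm0 : ∀ s ∈ Icc (0 : ℝ) 1, 0 ≤ m s) {f : ℝ → ℝ} {a : ℝ} (ha : 0 ≤ a)
    (hf : ContinuousOn f (Icc 0 1))
    (h : ∀ t ∈ Icc (0 : ℝ) 1, f t ≤ a + ∫ s in (0 : ℝ)..t, m s * f s) :
    ∀ t ∈ Icc (0 : ℝ) 1, f t ≤ 2 * a * Real.exp (2 * ∫ s in (0 : ℝ)..1, m s) := by
  let P : ℝ → ℝ := fun t => ∫ s in (0 : ℝ)..t, m s
  have h0 : (0 : ℝ) ∈ Icc (0 : ℝ) 1 := by simp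
  have h1 : (1 : ℝ) ∈ Icc (0 : ℝ) 1 := by simp
  have hP : ContinuousOn P (Icc 0 1) := continuousOn_primitive_Icc hm
  have hP0 (t : ℝ) (ht : t ∈ Icc (0 : ℝ) 1) : 0 ≤ P t := by
    simpa [P] using monotoneOn_primitive hm hm0 h0 ht ht.1
  obtain ⟨t₀, ht₀, hmax⟩ := isCompact_Icc.exists_isMaxOn (nonempty_Icc.2 zero_le_one)
    (hf.mul (Real.continuous_exp.comp_continuousOn (hP.const_mul (-2))))
  set S := f t₀ * Real.exp (-2 * P t₀) with hS
  have hfS (s : ℝ) (hs : s ∈ Icc (0 : ℝ) 1) : f s ≤ S * Real.exp (2 * P s) := by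
    have h2 : f s * Real.exp (-2 * P s) ≤ S := hmax hs
    calc f s = f s * Real.exp (-2 * P s) * Real.exp (2 * P s) := by
          rw [mul_assoc, ← Real.exp_add]; simp
      _ ≤ S * Real.exp (2 * P s) := by gcongr
  have hS2 : S ≤ 2 * a := by
    by_contra! hlt
    have hSpos : 0 < S := by linarith
    have h2 : ∫ s in (0 : ℝ)..t₀, m s * f s ≤ S * (1 / 2 * Real.exp (2 * P t₀)) := by
      calc ∫ s in (0 : ℝ)..t₀, m s * f s
          ≤ ∫ s in (0 : ℝ)..t₀, S * (m s * Real.exp (2 * P s)) := by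
            refine intervalIntegral.integral_mono_on ht₀.1
              ((intervalIntegrable_mul_of_continuousOn hm hf).mono_Icc h0 ht₀)
              (((intervalIntegrable_mul_of_continuousOn hm
                (Real.continuous_exp.comp_continuousOn (hP.const_mul 2))).const_mul S).mono_Icc
                h0 ht₀) fun s hs => ?_
            have hs' : s ∈ Icc (0 : ℝ) 1 := ⟨hs.1, hs.2.trans ht₀.2⟩
            nlinarith [mul_le_mul_of_nonneg_left (hfS s hs') (hm0 s hs')]
        _ ≤ S * (1 / 2 * Real.exp (2 * P t₀)) := by
            rw [intervalIntegral.integral_const_mul]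
            exact mul_le_mul_of_nonneg_left (integral_mul_exp_two_mul_le hm hm0 ht₀) hSpos.le
    have h3 : f t₀ ≤ a + S * (1 / 2 * Real.exp (2 * P t₀)) := (h t₀ ht₀).trans (by linarith)
    have h4 : f t₀ = S * Real.exp (2 * P t₀) := by
      rw [hS, mul_assoc, ← Real.exp_add]; simp
    have h5 : 1 ≤ Real.exp (2 * P t₀) := Real.one_le_exp (by linarith [hP0 t₀ ht₀])
    nlinarith
  intro t ht
  calc f t ≤ S * Real.exp (2 * P t) := hfS t ht
    _ ≤ 2 * a * Real.exp (2 * P t) := by gcongr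
    _ ≤ 2 * a * Real.exp (2 * P 1) := by
        gcongr
        exact monotoneOn_primitive hm hm0 ht h1 ht.2

end Gronwall

section LinearEquation

variable {E : Type*} [NormedAddCommGroup E] [NormedSpace ℝ E]

theorem ContinuousOn.aestronglyMeasurable_Ioc {F : Type*} [NormedAddCommGroup F] {f : ℝ → F}
    (hf : ContinuousOn f (Icc 0 1)) :
    AEStronglyMeasurable f (volume.restrict (Ioc (0 : ℝ) 1)) :=
  (hf.mono Ioc_subset_Icc_self).aestronglyMeasurable measurableSet_Ioc

theorem intervalIntegrable_comp_of_norm_le {A ψ : ℝ → E →L[ℝ] E} {m : ℝ → ℝ}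
    (hm : IntervalIntegrable m volume 0 1) (hA : ∀ s ∈ Icc (0 : ℝ) 1, ‖A s‖ ≤ m s)
    (hAm : AEStronglyMeasurable A (volume.restrict (Ioc 0 1))) (hψ : ContinuousOn ψ (Icc 0 1)) :
    IntervalIntegrable (fun s => A s ∘L ψ s) volume 0 1 := by
  have h := intervalIntegrable_mul_of_continuousOn hm hψ.norm
  rw [intervalIntegrable_iff_integrableOn_Ioc_of_le zero_le_one] at h ⊢
  refine Integrable.mono' h ?_ ?_
  · exact (ContinuousLinearMap.compL ℝ E E E).aestronglyMeasurable_comp₂ hAm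
      hψ.aestronglyMeasurable_Ioc
  · filter_upwards [ae_restrict_mem measurableSet_Ioc] with s hs
    exact (ContinuousLinearMap.opNorm_comp_le _ _).trans
      (mul_le_mul_of_nonneg_right (hA s (Ioc_subset_Icc_self hs)) (norm_nonneg _))

/-- The terms of the Picard series of the linear equation `Ψ' = A Ψ`, `Ψ 0 = id`. -/
noncomputable def picardTerm (A : ℝ → E → E →L[ℝ] E) : ℕ → ℝ → E → E →L[ℝ] E
  | 0 => fun _ _ => .id ℝ E
  | j + 1 => fun t x => ∫ s in (0 : ℝ)..t, A s x ∘L picardTerm A j s x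

/-- A linear equation whose coefficients depend on a parameter in a Hölder way has a solution which
depends on the parameter in the same way, with a bound by the integral of the Hölder norms. -/
theorem exists_holderBound_linear_solution [FiniteDimensional ℝ E] {β : ℝ} (hβ0 : 0 < β)
    (hβ1 : β ≤ 1) (k : ℕ) : ∃ c : ℝ, 0 ≤ c ∧ ∀ (A : ℝ → E → E →L[ℝ] E) (m : ℝ → ℝ),
      IntervalIntegrable m volume 0 1 → (∀ s ∈ Icc (0 : ℝ) 1, HolderBound k β (m s) (A s)) →
      (∀ x, AEStronglyMeasurable (fun s => A s x) (volume.restrict (Ioc 0 1))) →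
      ∃ Ψ : ℝ → E → E →L[ℝ] E, (∀ x, ContinuousOn (fun t => Ψ t x) (Icc 0 1)) ∧
        (∀ t ∈ Icc (0 : ℝ) 1,
          HolderBound k β (2 * Real.exp (2 * (c * ∫ s in (0 : ℝ)..1, m s))) (Ψ t)) ∧
        ∀ x, ∀ t ∈ Icc (0 : ℝ) 1,
          Ψ t x = .id ℝ E + ∫ s in (0 : ℝ)..t, A s x ∘L Ψ s x := by
  have : CompleteSpace E := FiniteDimensional.complete ℝ E
  obtain ⟨c, hc, hB⟩ := HolderBound.bilinear (E := E) hβ0 hβ1 k (ContinuousLinearMap.compL ℝ E E E)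
  refine ⟨c, hc, fun A m hm hA hAm => ?_⟩
  have h0 : (0 : ℝ) ∈ Icc (0 : ℝ) 1 := by simp
  have h1 : (1 : ℝ) ∈ Icc (0 : ℝ) 1 := by simp
  have hcm : IntervalIntegrable (fun s => c * m s) volume 0 1 := hm.const_mul c
  have hcm0 (s : ℝ) (hs : s ∈ Icc (0 : ℝ) 1) : 0 ≤ c * m s := mul_nonneg hc (hA s hs).nonneg
  let P : ℝ → ℝ := fun t => ∫ s in (0 : ℝ)..t, c * m s
  have hP : ContinuousOn P (Icc 0 1) := continuousOn_primitive_Icc hcm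
  have hPmono (t : ℝ) (ht : t ∈ Icc (0 : ℝ) 1) : P t ≤ P 1 :=
    monotoneOn_primitive hcm hcm0 ht h1 ht.2
  have hint {ψ : ℝ → E → E →L[ℝ] E} (x : E) (hψ : ContinuousOn (fun t => ψ t x) (Icc 0 1)) :
      IntervalIntegrable (fun s => A s x ∘L ψ s x) volume 0 1 :=
    intervalIntegrable_comp_of_norm_le hm (fun s hs => (hA s hs).norm_apply_le x) (hAm x) hψ
  let b : ℕ → ℝ → ℝ := fun j s => c * m s * ((1 / 2) ^ j * Real.exp (2 * P s))
  have hbint (j : ℕ) : IntervalIntegrable (b j) volume 0 1 :=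
    intervalIntegrable_mul_of_continuousOn hcm
      (continuousOn_const.mul (Real.continuous_exp.comp_continuousOn (hP.const_mul 2)))
  have hbI (j : ℕ) (t : ℝ) (ht : t ∈ Icc (0 : ℝ) 1) :
      ∫ s in (0 : ℝ)..t, b j s ≤ (1 / 2) ^ (j + 1) * Real.exp (2 * P t) := by
    have h : ∫ s in (0 : ℝ)..t, b j s =
        (1 / 2) ^ j * ∫ s in (0 : ℝ)..t, c * m s * Real.exp (2 * P s) := by
      rw [← intervalIntegral.integral_const_mul]
      exact intervalIntegral.integral_congr fun s _ => by simp only [b]; ring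
    rw [h, pow_succ, mul_assoc]
    exact mul_le_mul_of_nonneg_left (integral_mul_exp_two_mul_le hcm hcm0 ht) (by positivity)
  have hψ (j : ℕ) : (∀ x, ContinuousOn (fun t => picardTerm A j t x) (Icc 0 1)) ∧
      ∀ t ∈ Icc (0 : ℝ) 1,
        HolderBound k β ((1 / 2) ^ j * Real.exp (2 * P t)) (picardTerm A j t) := by
    induction j with
    | zero =>
      refine ⟨fun x => continuousOn_const, fun t ht => .const _ ?_⟩
      have : 0 ≤ P t := by simpa [P] using monotoneOn_primitive hcm hcm0 h0 ht ht.1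
      rw [pow_zero, one_mul]
      exact ContinuousLinearMap.norm_id_le.trans (Real.one_le_exp (by linarith))
    | succ j ih =>
      refine ⟨fun x => continuousOn_primitive_Icc (hint x (ih.1 x)), fun t ht => ?_⟩
      simp only [picardTerm, intervalIntegral.integral_of_le ht.1]
      refine (HolderBound.integral (m := b j) hβ0 (fun x => ?_) ?_ ?_).mono ?_
      · exact ((hint x (ih.1 x)).mono_Icc h0 ht).1.aestronglyMeasurable
      · filter_upwards [ae_restrict_mem measurableSet_Ioc] with s hs
        have hs' : s ∈ Icc (0 : ℝ) 1 := ⟨hs.1.le, hs.2.trans ht.2⟩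
        exact hB _ _ _ _ (hA s hs') (ih.2 s hs')
      · exact ((hbint j).mono_Icc h0 ht).1
      · rw [← intervalIntegral.integral_of_le ht.1]
        exact hbI j t ht
  have hgeom (K : ℝ) : HasSum (fun j : ℕ => (1 / 2 : ℝ) ^ j * K) (2 * K) :=
    hasSum_geometric_two.mul_right K
  have hΨc (x : E) : ContinuousOn (fun t => ∑' j, picardTerm A j t x) (Icc 0 1) := by
    refine continuousOn_tsum (fun j => (hψ j).1 x) (hgeom (Real.exp (2 * P 1))).summable
      fun j t ht => (((hψ j).2 t ht).norm_apply_le x).trans ?_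
    gcongr
    exact hPmono t ht
  refine ⟨fun t x => ∑' j, picardTerm A j t x, hΨc, fun t ht => ?_, fun x t ht => ?_⟩
  · have h := HolderBound.tsum (fun j => (hψ j).2 t ht) (hgeom _).summable
    rw [(hgeom _).tsum_eq] at h
    refine h.mono ?_
    rw [← intervalIntegral.integral_const_mul c]
    have := hPmono t ht
    gcongr
  · have hs (s : ℝ) (hs : s ∈ Icc (0 : ℝ) 1) : Summable fun j => picardTerm A j s x :=
      (hgeom _).summable.of_norm_bounded fun j => ((hψ j).2 s hs).norm_apply_le x
    beta_reduce
    rw [(hs t ht).tsum_eq_zero_add]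
    congr 1
    have hi (j : ℕ) := (hint x ((hψ j).1 x)).mono_Icc h0 ht
    have hmem : ∀ᵐ s ∂volume.restrict (Ioc 0 t), s ∈ Icc (0 : ℝ) 1 := by
      filter_upwards [ae_restrict_mem measurableSet_Ioc] with s hs
      exact ⟨hs.1.le, hs.2.trans ht.2⟩
    have hsum : Summable fun j =>
        ∫ s in Ioc 0 t, ‖A s x ∘L picardTerm A j s x‖ := by
      refine ((hgeom (Real.exp (2 * P t))).summable.comp_injective
        (add_left_injective 1)).of_nonneg_of_le
        (fun j => integral_nonneg fun s => norm_nonneg _) fun j => ?_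
      refine le_trans ?_ (hbI j t ht)
      rw [intervalIntegral.integral_of_le ht.1]
      refine integral_mono_ae (hi j).1.norm ((hbint j).mono_Icc h0 ht).1 ?_
      filter_upwards [hmem] with s hs
      exact (hB _ _ _ _ (hA s hs) ((hψ j).2 s hs)).norm_apply_le x
    have := hasSum_integral_of_summable_integral_norm (fun j => (hi j).1) hsum
    simp only [picardTerm, intervalIntegral.integral_of_le ht.1]
    rw [this.tsum_eq]
    refine integral_congr_ae ?_
    filter_upwards [hmem] with s hs'
    exact ((ContinuousLinearMap.compL ℝ E E E (A s x)).map_tsum (hs s hs')).symm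

end LinearEquation

namespace IsPointwiseFlow

variable {d : ℕ} {β : ℝ} {u Φ : ℝ → Euc d → Euc d} {m : ℝ → ℝ}

theorem continuousOn (hΦ : IsPointwiseFlow u Φ) (x : Euc d) :
    ContinuousOn (fun t => Φ t x) (Icc 0 1) :=
  (continuousOn_const.add (continuousOn_primitive_Icc (hΦ x).1)).congr (hΦ x).2

theorem sub_eq (hΦ : IsPointwiseFlow u Φ) (x y : Euc d) {t : ℝ} (ht : t ∈ Icc (0 : ℝ) 1) :
    Φ t y - Φ t x = (y - x) + ∫ s in (0 : ℝ)..t, (u s (Φ s y) - u s (Φ s x)) := by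
  have h0 : (0 : ℝ) ∈ Icc (0 : ℝ) 1 := by simp
  rw [(hΦ x).2 t ht, (hΦ y).2 t ht, intervalIntegral.integral_sub ((hΦ y).1.mono_Icc h0 ht)
    ((hΦ x).1.mono_Icc h0 ht)]
  abel

theorem norm_sub_id_le (hΦ : IsPointwiseFlow u Φ) (hm : IntervalIntegrable m volume 0 1)
    (hu : ∀ s ∈ Icc (0 : ℝ) 1, ∀ x, ‖u s x‖ ≤ m s) (x : Euc d) {t : ℝ}
    (ht : t ∈ Icc (0 : ℝ) 1) : ‖Φ t x - x‖ ≤ ∫ s in (0 : ℝ)..1, m s := by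
  have h0 : (0 : ℝ) ∈ Icc (0 : ℝ) 1 := by simp
  have h1 : (1 : ℝ) ∈ Icc (0 : ℝ) 1 := by simp
  rw [(hΦ x).2 t ht, add_sub_cancel_left]
  calc ‖∫ s in (0 : ℝ)..t, u s (Φ s x)‖ ≤ ∫ s in (0 : ℝ)..t, m s := by
        refine intervalIntegral.norm_integral_le_of_norm_le ht.1 ?_ (hm.mono_Icc h0 ht)
        exact .of_forall fun s hs => hu s ⟨hs.1.le, hs.2.trans ht.2⟩ _
    _ ≤ ∫ s in (0 : ℝ)..1, m s := monotoneOn_primitive hm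
        (fun s hs => (norm_nonneg _).trans (hu s hs 0)) ht h1 ht.2

theorem norm_flow_sub_le (hΦ : IsPointwiseFlow u Φ) (hm : IntervalIntegrable m volume 0 1)
    (hu : ∀ s ∈ Icc (0 : ℝ) 1, HolderBound 1 β (m s) (u s)) (x y : Euc d) {t : ℝ}
    (ht : t ∈ Icc (0 : ℝ) 1) :
    ‖Φ t x - Φ t y‖ ≤ 2 * Real.exp (2 * ∫ s in (0 : ℝ)..1, m s) * ‖x - y‖ := by
  have h0 : (0 : ℝ) ∈ Icc (0 : ℝ) 1 := by simp
  have hc : ContinuousOn (fun s => ‖Φ s x - Φ s y‖) (Icc 0 1) :=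
    ((hΦ.continuousOn x).sub (hΦ.continuousOn y)).norm
  have h := gronwall_integrable hm (fun s hs => (hu s hs).nonneg) (norm_nonneg (x - y)) hc
    (fun t ht => ?_) t ht
  · linarith
  · rw [hΦ.sub_eq y x ht]
    refine (norm_add_le _ _).trans (add_le_add le_rfl ?_)
    refine intervalIntegral.norm_integral_le_of_norm_le ht.1 (.of_forall fun s hs => ?_)
      ((intervalIntegrable_mul_of_continuousOn hm hc).mono_Icc h0 ht)
    have hus := hu s ⟨hs.1.le, hs.2.trans ht.2⟩
    exact convex_univ.norm_image_sub_le_of_norm_fderiv_le (fun x _ => hus.differentiable x)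
      (fun x _ => hus.fderiv.norm_apply_le x) (mem_univ _) (mem_univ _)

/-- The spatial derivative of the flow is the solution of the linearized equation. -/
theorem hasFDerivAt (hΦ : IsPointwiseFlow u Φ) (hβ : 0 < β) (hm : IntervalIntegrable m volume 0 1)
    (hu : ∀ s ∈ Icc (0 : ℝ) 1, HolderBound 1 β (m s) (u s)) (x : Euc d)
    {ψ : ℝ → Euc d →L[ℝ] Euc d} (hψc : ContinuousOn ψ (Icc 0 1))
    (hAm : AEStronglyMeasurable (fun s => fderiv ℝ (u s) (Φ s x)) (volume.restrict (Ioc 0 1)))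
    (hψ : ∀ t ∈ Icc (0 : ℝ) 1,
      ψ t = .id ℝ (Euc d) + ∫ s in (0 : ℝ)..t, fderiv ℝ (u s) (Φ s x) ∘L ψ s)
    {t : ℝ} (ht : t ∈ Icc (0 : ℝ) 1) : HasFDerivAt (Φ t) (ψ t) x := by
  have h0 : (0 : ℝ) ∈ Icc (0 : ℝ) 1 := by simp
  have h1 : (1 : ℝ) ∈ Icc (0 : ℝ) 1 := by simp
  have hm0 (s : ℝ) (hs : s ∈ Icc (0 : ℝ) 1) : 0 ≤ m s := (hu s hs).nonneg
  have hAψ : IntervalIntegrable (fun s => fderiv ℝ (u s) (Φ s x) ∘L ψ s) volume 0 1 :=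
    intervalIntegrable_comp_of_norm_le hm (fun s hs => (hu s hs).fderiv.norm_apply_le _) hAm hψc
  set I := ∫ s in (0 : ℝ)..1, m s with hI
  have hI0 : 0 ≤ I := intervalIntegral.integral_nonneg zero_le_one hm0
  set L := 2 * Real.exp (2 * I) with hL
  have hL0 : 0 ≤ L := by positivity
  have hbound (y : Euc d) : ‖Φ t y - Φ t x - ψ t (y - x)‖ ≤
      I * L * (L * ‖y - x‖) ^ β * L * ‖y - x‖ := by
    set a := (L * ‖y - x‖) ^ β * (L * ‖y - x‖) with ha
    have ha0 : 0 ≤ a := by positivity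
    have hc : ContinuousOn (fun s => ‖Φ s y - Φ s x - ψ s (y - x)‖) (Icc 0 1) :=
      (((hΦ.continuousOn y).sub (hΦ.continuousOn x)).sub
        (hψc.clm_apply continuousOn_const)).norm
    have h := gronwall_integrable hm hm0 (mul_nonneg hI0 ha0) hc (fun t ht => ?_) t ht
    · calc _ ≤ _ := h
        _ = _ := by rw [hL, ha]; ring
    · have hAψt := hAψ.mono_Icc h0 ht
      have hAψy : IntervalIntegrable (fun s => fderiv ℝ (u s) (Φ s x) (ψ s (y - x))) volume 0 t :=
        ⟨hAψt.1.apply_continuousLinearMap (y - x), hAψt.2.apply_continuousLinearMap (y - x)⟩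
      have hdiff : Φ t y - Φ t x - ψ t (y - x) = ∫ s in (0 : ℝ)..t,
          (u s (Φ s y) - u s (Φ s x) - fderiv ℝ (u s) (Φ s x) (ψ s (y - x))) := by
        rw [intervalIntegral.integral_sub (((hΦ y).1.sub (hΦ x).1).mono_Icc h0 ht)
          hAψy, hΦ.sub_eq x y ht, hψ t ht,
          _root_.add_apply,
          ContinuousLinearMap.intervalIntegral_apply hAψt]
        simp
      have hmf := intervalIntegrable_mul_of_continuousOn hm hc
      calc ‖Φ t y - Φ t x - ψ t (y - x)‖
          ≤ ∫ s in (0 : ℝ)..t, (m s * a + m s * ‖Φ s y - Φ s x - ψ s (y - x)‖) := by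
            rw [hdiff]
            refine intervalIntegral.norm_integral_le_of_norm_le ht.1 (.of_forall fun s hs => ?_)
              (((hm.mul_const a).add hmf).mono_Icc h0 ht)
            have hs' : s ∈ Icc (0 : ℝ) 1 := ⟨hs.1.le, hs.2.trans ht.2⟩
            have hms := hm0 s hs'
            have hΦs := hΦ.norm_flow_sub_le hm hu y x hs'
            have hsplit : u s (Φ s y) - u s (Φ s x) - fderiv ℝ (u s) (Φ s x) (ψ s (y - x)) =
                (u s (Φ s y) - u s (Φ s x) - fderiv ℝ (u s) (Φ s x) (Φ s y - Φ s x)) +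
                  fderiv ℝ (u s) (Φ s x) (Φ s y - Φ s x - ψ s (y - x)) := by
              rw [map_sub _ _ (ψ s (y - x))]
              abel
            rw [hsplit]
            refine (norm_add_le _ _).trans (add_le_add ?_ ?_)
            · calc _ ≤ m s * ‖Φ s y - Φ s x‖ ^ β * ‖Φ s y - Φ s x‖ :=
                    (hu s hs').norm_sub_sub_fderiv_le hβ _ _
                _ ≤ m s * (L * ‖y - x‖) ^ β * (L * ‖y - x‖) := by gcongr
                _ = m s * a := by ring
            · exact ((fderiv ℝ (u s) (Φ s x)).le_opNorm _).trans (mul_le_mul_of_nonneg_right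
                ((hu s hs').fderiv.norm_apply_le _) (norm_nonneg _))
        _ = (∫ s in (0 : ℝ)..t, m s) * a +
              ∫ s in (0 : ℝ)..t, m s * ‖Φ s y - Φ s x - ψ s (y - x)‖ := by
            rw [intervalIntegral.integral_add ((hm.mul_const a).mono_Icc h0 ht)
              (hmf.mono_Icc h0 ht), intervalIntegral.integral_mul_const]
        _ ≤ I * a + ∫ s in (0 : ℝ)..t, m s * ‖Φ s y - Φ s x - ψ s (y - x)‖ := by
            gcongr
            exact monotoneOn_primitive hm hm0 ht h1 ht.2
  rw [hasFDerivAt_iff_isLittleO, Asymptotics.isLittleO_iff]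
  intro ε hε
  have hcont : Continuous fun y => I * L * (L * ‖y - x‖) ^ β * L :=
    (continuous_const.mul ((by fun_prop : Continuous fun y => L * ‖y - x‖).rpow_const
      fun _ => Or.inr hβ.le)).mul continuous_const
  have hlim := hcont.tendsto x
  simp only [sub_self, norm_zero, mul_zero, Real.zero_rpow hβ.ne', zero_mul] at hlim
  filter_upwards [hlim.eventually (ge_mem_nhds hε)] with y hy
  exact (hbound y).trans (mul_le_mul_of_nonneg_right hy (norm_nonneg _))

theorem aestronglyMeasurable_fderiv (hΦ : IsPointwiseFlow u Φ)
    (hmeas : ∀ x, AEStronglyMeasurable (fun t => u t x) (volume.restrict (Icc (0 : ℝ) 1)))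
    (hu : ∀ s ∈ Icc (0 : ℝ) 1, HolderBound 1 β (m s) (u s)) (x : Euc d) :
    AEStronglyMeasurable (fun s => fderiv ℝ (u s) (Φ s x)) (volume.restrict (Ioc 0 1)) := by
  have hmem : ∀ᵐ s ∂volume.restrict (Ioc (0 : ℝ) 1), s ∈ Icc (0 : ℝ) 1 :=
    (ae_restrict_mem measurableSet_Ioc).mono fun s hs => Ioc_subset_Icc_self hs
  refine aestronglyMeasurable_fderiv_of_apply (fun v => ?_)
    (hmem.mono fun s hs => (hu s hs).differentiable _)
  exact aestronglyMeasurable_comp_of_continuous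
    (fun z => (hmeas z).mono_measure (Measure.restrict_mono_set _ Ioc_subset_Icc_self))
    (hmem.mono fun s hs => (hu s hs).continuous)
    ((hΦ.continuousOn x).add continuousOn_const).aestronglyMeasurable_Ioc

/-- The flow is bounded in `C^{k,β}` for `k ≤ n`, in terms of the integral of the `C^{n,β}`
norms. -/
theorem exists_holderBound (d : ℕ) {n : ℕ} (hn : 1 ≤ n) (hβ0 : 0 < β) (hβ1 : β ≤ 1) {R : ℝ}
    (hR : 0 ≤ R) {k : ℕ} (hk : k ≤ n) :
    ∃ C : ℝ, 0 ≤ C ∧ ∀ (u Φ : ℝ → Euc d → Euc d) (m : ℝ → ℝ), IsPointwiseFlow u Φ →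
      (∀ x, AEStronglyMeasurable (fun t => u t x) (volume.restrict (Icc (0 : ℝ) 1))) →
      IntervalIntegrable m volume 0 1 → (∀ s ∈ Icc (0 : ℝ) 1, HolderBound n β (m s) (u s)) →
      (∫ s in (0 : ℝ)..1, m s) ≤ R →
      ∀ t ∈ Icc (0 : ℝ) 1, HolderBound k β C (fun x => Φ t x - x) := by
  set L := 2 * Real.exp (2 * (2 ^ (n - 1) * R)) with hL
  have hL0 : 0 ≤ L := by positivity
  have lip (u Φ : ℝ → Euc d → Euc d) (m : ℝ → ℝ) (hΦ : IsPointwiseFlow u Φ)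
      (hm : IntervalIntegrable m volume 0 1)
      (hu : ∀ s ∈ Icc (0 : ℝ) 1, HolderBound n β (m s) (u s))
      (hmR : (∫ s in (0 : ℝ)..1, m s) ≤ R) (t : ℝ) (ht : t ∈ Icc (0 : ℝ) 1) (x y : Euc d) :
      ‖Φ t x - Φ t y‖ ≤ L * ‖x - y‖ := by
    refine (hΦ.norm_flow_sub_le (hm.const_mul (2 ^ (n - 1)))
      (fun s hs => (hu s hs).of_le hβ0 hβ1 hn) x y ht).trans ?_
    rw [intervalIntegral.integral_const_mul, hL]
    gcongr
  induction k with
  | zero =>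
    refine ⟨2 * (R + (L + 1)), by positivity, fun u Φ m hΦ hmeas hm hu hmR t ht => ?_⟩
    refine .of_lipschitz hβ0 hβ1 (fun x => ?_) fun x y => ?_
    · linarith [hΦ.norm_sub_id_le hm (fun s hs => (hu s hs).norm_apply_le) x ht]
    · have h1 : Φ t x - x - (Φ t y - y) = (Φ t x - Φ t y) - (x - y) := by abel
      rw [h1]
      nlinarith [norm_sub_le (Φ t x - Φ t y) (x - y), lip u Φ m hΦ hm hu hmR t ht x y,
        norm_nonneg (x - y), mul_nonneg hR (norm_nonneg (x - y))]
  | succ k ih =>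
    obtain ⟨C, hC, ih⟩ := ih (by omega)
    obtain ⟨b, hb, hcomp⟩ := HolderBound.comp_id_add (E := Euc d) (F := Euc d →L[ℝ] Euc d)
      hβ0 hβ1 k hC hL0
    obtain ⟨c, hc, hlin⟩ := exists_holderBound_linear_solution (E := Euc d) hβ0 hβ1 k
    set q : ℝ := b * 2 ^ (n - (k + 1)) with hq
    set D := 2 * Real.exp (2 * (c * (q * R))) with hD
    refine ⟨R + (D + 1), by positivity, fun u Φ m hΦ hmeas hm hu hmR t ht => ?_⟩
    have hu1 (s : ℝ) (hs : s ∈ Icc (0 : ℝ) 1) : HolderBound 1 β (2 ^ (n - 1) * m s) (u s) :=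
      (hu s hs).of_le hβ0 hβ1 hn
    have hAm := hΦ.aestronglyMeasurable_fderiv hmeas hu1
    have hA (s : ℝ) (hs : s ∈ Icc (0 : ℝ) 1) :
        HolderBound k β (q * m s) (fun x => fderiv ℝ (u s) (Φ s x)) := by
      rw [hq, mul_assoc]
      exact hcomp _ _ _ ((hu s hs).of_le hβ0 hβ1 hk).fderiv (ih u Φ m hΦ hmeas hm hu hmR s hs)
        (lip u Φ m hΦ hm hu hmR s hs)
    obtain ⟨Ψ, hΨc, hΨb, hΨ⟩ := hlin _ _ (hm.const_mul q) hA hAm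
    have hd (x : Euc d) : HasFDerivAt (fun x => Φ t x - x) (Ψ t x + -.id ℝ (Euc d)) x := by
      rw [← sub_eq_add_neg]
      exact (hΦ.hasFDerivAt hβ0 (hm.const_mul _) hu1 x (hΨc x) (hAm x) (hΨ x) ht).sub
        (hasFDerivAt_id x)
    refine HolderBound.succ_iff.2 ⟨fun x => (hd x).differentiableAt, fun x => ?_, ?_⟩
    · have hD0 : 0 ≤ D := by positivity
      linarith [hΦ.norm_sub_id_le hm (fun s hs => (hu s hs).norm_apply_le) x ht]
    · rw [funext fun x => (hd x).fderiv]
      have hid : HolderBound k β 1 (fun _ : Euc d => -ContinuousLinearMap.id ℝ (Euc d)) :=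
        .const _ ((norm_neg _).trans_le ContinuousLinearMap.norm_id_le)
      refine ((hΨb t ht).add hid).mono ?_
      rw [intervalIntegral.integral_const_mul]
      have h1 : 2 * Real.exp (2 * (c * (q * ∫ s in (0 : ℝ)..1, m s))) ≤ D := by
        rw [hD]
        gcongr
      linarith

end IsPointwiseFlow

/-- **Statement 18** (boundedness of the flow map): for every `R > 0` there is
`C > 0` such that for every pointwise time-dependent `C^{n,β}_0`-vector field
`u` with `∫₀¹ ‖u(t,·)‖_{n,β} dt ≤ R`, the pointwise flow `Φ` of `u` satisfies
`‖Φ(t,·) − Id‖_{n,β} ≤ C` for all `t ∈ [0,1]` (in particular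
`Φ(t,·) − Id` has finite `C^{n,β}`-norm). -/
theorem stmt18 (d n : ℕ) (hn : 1 ≤ n) (β : ℝ) (hβ0 : 0 < β) (hβ1 : β ≤ 1) :
    ∀ R > (0 : ℝ), ∃ C > (0 : ℝ),
      ∀ u : ℝ → Euc d → Euc d, PointwiseVF d n β u →
        (∫ t in Icc (0 : ℝ) 1, hnorm n β (u t)) ≤ R →
        ∀ Φ : ℝ → Euc d → Euc d, IsPointwiseFlow u Φ →
          ∀ t ∈ Icc (0 : ℝ) 1,
            eHnorm n β (fun x => Φ t x - x) ≤ ENNReal.ofReal C := by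
  intro R hR
  obtain ⟨C, hC, h⟩ := IsPointwiseFlow.exists_holderBound d hn hβ0 hβ1 hR.le le_rfl
  refine ⟨C + 1, by positivity, fun u hu huR Φ hΦ t ht => ?_⟩
  have hm : IntervalIntegrable (fun t => hnorm n β (u t)) volume 0 1 :=
    (intervalIntegrable_iff_integrableOn_Icc_of_le zero_le_one).2 hu.2.2
  rw [integral_Icc_eq_integral_Ioc, ← intervalIntegral.integral_of_le zero_le_one] at huR
  exact ((h u Φ _ hΦ hu.2.1 hm (fun s hs => (hu.1 s hs).holderBound) huR t ht).mono
    (by linarith)).eHnorm_le
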